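/- arXiv:2401.12207 — 7 statements merged into one kernel-verified Lean document; each statement's English description precedes it below -/
import Mathlib

section
/- Let 𝒳 be a nonempty finite set, n a positive integer, and c : 𝒳 × 𝒳 → [0,∞) a cost function. For any probability mass functions p and q on 𝒳ⁿ, φ(p,q) ≥ ∑_{t=1}^n φ_1(p_t, q_t), where p_t and q_t denote the t-th coordinate marginals of p and q and φ_1 is the corresponding single-coordinate transport cost (the case n = 1). Moreover, if p = ⊗_{t=1}^n p_t and q = ⊗_{t=1}^n q_t are product pmfs, then equality holds: φ(p,q) = ∑_{t=1}^n φ_1(p_t, q_t). -/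
open Finset

/-- `p` is a probability mass function on the finite type `α`. -/
def IsPMF {α : Type*} [Fintype α] (p : α → ℝ) : Prop :=
  (∀ a, 0 ≤ p a) ∧ ∑ a, p a = 1

/-- `π` is a coupling of the pmfs `p` and `q`. -/
def IsCoupling {α : Type*} [Fintype α] (p q : α → ℝ) (π : α × α → ℝ) : Prop :=
  IsPMF π ∧ (∀ a, ∑ b, π (a, b) = p a) ∧ (∀ b, ∑ a, π (a, b) = q b)

/-- The transport divergence `φ(p,q)` between pmfs on `𝒳ⁿ` induced by the
single-letter cost `c`. -/
noncomputable def transportCost {𝒳 : Type*} [Fintype 𝒳] (n : ℕ) (c : 𝒳 → 𝒳 → ℝ)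
    (p q : (Fin n → 𝒳) → ℝ) : ℝ :=
  sInf { v | ∃ π : ((Fin n → 𝒳) × (Fin n → 𝒳)) → ℝ, IsCoupling p q π ∧
    v = ∑ z : (Fin n → 𝒳) × (Fin n → 𝒳), π z * ∑ t, c (z.1 t) (z.2 t) }

/-- The single-coordinate transport cost `φ₁(p,q)` (the case `n = 1`). -/
noncomputable def transportCost1 {𝒳 : Type*} [Fintype 𝒳] (c : 𝒳 → 𝒳 → ℝ)
    (p q : 𝒳 → ℝ) : ℝ :=
  sInf { v | ∃ π : 𝒳 × 𝒳 → ℝ, IsCoupling p q π ∧ v = ∑ z : 𝒳 × 𝒳, π z * c z.1 z.2 }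

/-- The `t`-th coordinate marginal of a pmf on `𝒳ⁿ`. -/
noncomputable def coordMarginal {𝒳 : Type*} [Fintype 𝒳] [DecidableEq 𝒳] (n : ℕ)
    (p : (Fin n → 𝒳) → ℝ) (t : Fin n) (a : 𝒳) : ℝ :=
  ∑ x : Fin n → 𝒳, if x t = a then p x else 0

/-- The pushforward of a mass function `p` along `f`. -/
noncomputable def pushMass {α β : Type*} [Fintype α] [DecidableEq β] (f : α → β) (p : α → ℝ)
    (b : β) : ℝ :=
  ∑ a, if f a = b then p a else 0

lemma sum_pushMass_mul {α β : Type*} [Fintype α] [Fintype β] [DecidableEq β] (f : α → β)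
    (p : α → ℝ) (g : β → ℝ) : ∑ b, pushMass f p b * g b = ∑ a, p a * g (f a) := by
  simp only [pushMass, Finset.sum_mul, ite_mul, zero_mul]
  rw [Finset.sum_comm]
  simp

lemma IsPMF.pushMass {α β : Type*} [Fintype α] [Fintype β] [DecidableEq β] {p : α → ℝ}
    (hp : IsPMF p) (f : α → β) : IsPMF (pushMass f p) := by
  refine ⟨fun b => Finset.sum_nonneg fun a _ => ?_, ?_⟩
  · split_ifs
    exacts [hp.1 a, le_rfl]
  · simpa [hp.2] using sum_pushMass_mul f p 1

lemma IsCoupling.pushMass {α β : Type*} [Fintype α] [Fintype β] [DecidableEq β] {p q : α → ℝ}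
    {π : α × α → ℝ} (h : IsCoupling p q π) (f : α → β) :
    IsCoupling (pushMass f p) (pushMass f q) (pushMass (Prod.map f f) π) := by
  obtain ⟨hπ, h1, h2⟩ := h
  refine ⟨hπ.pushMass _, fun a => ?_, fun b => ?_⟩
  · simp only [_root_.pushMass, ← h1]
    rw [Finset.sum_comm, Fintype.sum_prod_type]
    refine Finset.sum_congr rfl fun x _ => ?_
    by_cases hx : f x = a <;> simp [hx]
  · simp only [_root_.pushMass, ← h2]
    rw [Finset.sum_comm, Fintype.sum_prod_type_right]
    refine Finset.sum_congr rfl fun y _ => ?_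
    by_cases hy : f y = b <;> simp [hy]

lemma IsPMF.isCoupling_mul {α : Type*} [Fintype α] {p q : α → ℝ} (hp : IsPMF p) (hq : IsPMF q) :
    IsCoupling p q fun z => p z.1 * q z.2 := by
  refine ⟨⟨fun z => mul_nonneg (hp.1 _) (hq.1 _), ?_⟩, fun a => ?_, fun b => ?_⟩
  · rw [Fintype.sum_prod_type]
    simp [← Finset.mul_sum, hp.2, hq.2]
  · simp [← Finset.mul_sum, hq.2]
  · simp [← Finset.sum_mul, hp.2]

lemma transportCost1_le {𝒳 : Type*} [Fintype 𝒳] {c : 𝒳 → 𝒳 → ℝ} (hc : ∀ x y, 0 ≤ c x y)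
    {p q : 𝒳 → ℝ} {π : 𝒳 × 𝒳 → ℝ} (h : IsCoupling p q π) :
    transportCost1 c p q ≤ ∑ z : 𝒳 × 𝒳, π z * c z.1 z.2 := by
  refine csInf_le ⟨0, ?_⟩ ⟨π, h, rfl⟩
  rintro _ ⟨π, h, rfl⟩
  exact Finset.sum_nonneg fun z _ => mul_nonneg (h.1.1 z) (hc _ _)

lemma transportCost_le {𝒳 : Type*} [Fintype 𝒳] {n : ℕ} {c : 𝒳 → 𝒳 → ℝ}
    (hc : ∀ x y, 0 ≤ c x y) {p q : (Fin n → 𝒳) → ℝ} {π : (Fin n → 𝒳) × (Fin n → 𝒳) → ℝ}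
    (h : IsCoupling p q π) :
    transportCost n c p q
      ≤ ∑ z : (Fin n → 𝒳) × (Fin n → 𝒳), π z * ∑ t, c (z.1 t) (z.2 t) := by
  refine csInf_le ⟨0, ?_⟩ ⟨π, h, rfl⟩
  rintro _ ⟨π, h, rfl⟩
  exact Finset.sum_nonneg fun z _ =>
    mul_nonneg (h.1.1 z) (Finset.sum_nonneg fun t _ => hc _ _)

lemma exists_isCoupling_lt {𝒳 : Type*} [Fintype 𝒳] (c : 𝒳 → 𝒳 → ℝ) {p q : 𝒳 → ℝ}
    (hp : IsPMF p) (hq : IsPMF q) {ε : ℝ} (hε : 0 < ε) :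
    ∃ π, IsCoupling p q π ∧ ∑ z : 𝒳 × 𝒳, π z * c z.1 z.2 < transportCost1 c p q + ε := by
  obtain ⟨_, ⟨π, h, rfl⟩, hlt⟩ := exists_lt_of_csInf_lt
    (s := { v | ∃ π : 𝒳 × 𝒳 → ℝ, IsCoupling p q π ∧ v = ∑ z : 𝒳 × 𝒳, π z * c z.1 z.2 })
    ⟨_, _, hp.isCoupling_mul hq, rfl⟩ (lt_add_of_pos_right (transportCost1 c p q) hε)
  exact ⟨π, h, hlt⟩

lemma sum_prod_mul_apply {ι α : Type*} [Fintype ι] [DecidableEq ι] [Fintype α]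
    {p : ι → α → ℝ} (hp : ∀ i, ∑ a, p i a = 1) (t : ι) (g : α → ℝ) :
    ∑ x : ι → α, (∏ i, p i (x i)) * g (x t) = ∑ a, p t a * g a := by
  have key (x : ι → α) :
      (∏ i, p i (x i)) * g (x t) = ∏ i, p i (x i) * (if i = t then g (x i) else 1) := by
    rw [Finset.prod_mul_distrib]
    simp
  simp only [key]
  rw [← Fintype.prod_sum fun i a => p i a * (if i = t then g a else 1),
    Finset.prod_eq_single t]
  · simp
  · intro i _ hi
    simp [hi, hp]
  · simp

lemma sum_prod_pair {ι α : Type*} [Fintype ι] [DecidableEq ι] [Fintype α]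
    (F : (ι → α) × (ι → α) → ℝ) :
    ∑ z, F z = ∑ w : ι → α × α, F (fun i => (w i).1, fun i => (w i).2) :=
  (Equiv.sum_comp (Equiv.arrowProdEquivProdArrow ι (fun _ => α) (fun _ => α)) F).symm

lemma IsCoupling.pi {ι α : Type*} [Fintype ι] [DecidableEq ι] [Fintype α]
    {p q : ι → α → ℝ} {π : ι → α × α → ℝ} (h : ∀ i, IsCoupling (p i) (q i) (π i)) :
    IsCoupling (fun x : ι → α => ∏ i, p i (x i)) (fun x => ∏ i, q i (x i))
      (fun z => ∏ i, π i (z.1 i, z.2 i)) := by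
  refine ⟨⟨fun z => Finset.prod_nonneg fun i _ => (h i).1.1 _, ?_⟩, fun x => ?_, fun y => ?_⟩
  · rw [sum_prod_pair]
    simp [← Fintype.prod_sum, (h _).1.2]
  · rw [← Fintype.prod_sum fun i b => π i (x i, b)]
    simp [(h _).2.1]
  · rw [← Fintype.prod_sum fun i a => π i (a, y i)]
    simp [(h _).2.2]

lemma sum_mul_sum_eq_sum_cost {𝒳 ι : Type*} [Fintype 𝒳] [Fintype ι] [DecidableEq ι]
    (c : 𝒳 → 𝒳 → ℝ) (π : (ι → 𝒳) × (ι → 𝒳) → ℝ) :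
    ∑ z, π z * ∑ t, c (z.1 t) (z.2 t) = ∑ t, ∑ z, π z * c (z.1 t) (z.2 t) := by
  simp only [Finset.mul_sum]
  exact Finset.sum_comm

/-- Tensorizability of the transport divergence: `φ(p,q) ≥ ∑_t φ₁(p_t, q_t)`, with
equality when `p` and `q` are product pmfs. -/
theorem transportCost_tensorization {𝒳 : Type*} [Fintype 𝒳] [DecidableEq 𝒳] [Nonempty 𝒳]
    (n : ℕ) (hn : 0 < n) (c : 𝒳 → 𝒳 → ℝ)
    (hc0 : ∀ x y, 0 ≤ c x y) (hcz : ∀ x y, c x y = 0 ↔ x = y)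
    (p q : (Fin n → 𝒳) → ℝ) (hp : IsPMF p) (hq : IsPMF q) :
    (∑ t, transportCost1 c (coordMarginal n p t) (coordMarginal n q t))
        ≤ transportCost n c p q ∧
    ((∀ x, p x = ∏ t, coordMarginal n p t (x t)) →
      (∀ x, q x = ∏ t, coordMarginal n q t (x t)) →
      transportCost n c p q
        = ∑ t, transportCost1 c (coordMarginal n p t) (coordMarginal n q t)) := by
  have hpt (t : Fin n) : IsPMF (coordMarginal n p t) := hp.pushMass fun x => x t
  have hqt (t : Fin n) : IsPMF (coordMarginal n q t) := hq.pushMass fun x => x t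
  have lower : (∑ t, transportCost1 c (coordMarginal n p t) (coordMarginal n q t))
      ≤ transportCost n c p q := by
    refine le_csInf ⟨_, _, hp.isCoupling_mul hq, rfl⟩ ?_
    rintro _ ⟨π, h, rfl⟩
    rw [sum_mul_sum_eq_sum_cost]
    refine Finset.sum_le_sum fun t _ => ?_
    refine (transportCost1_le hc0 (h.pushMass fun x => x t)).trans_eq ?_
    exact sum_pushMass_mul _ π fun z : 𝒳 × 𝒳 => c z.1 z.2
  refine ⟨lower, fun hpp hqp => le_antisymm (le_of_forall_pos_le_add fun ε hε => ?_) lower⟩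
  have hn' : (0 : ℝ) < n := Nat.cast_pos.2 hn
  choose π hπ hlt using fun t => exists_isCoupling_lt c (hpt t) (hqt t) (div_pos hε hn')
  have hcoup := IsCoupling.pi hπ
  rw [← funext hpp, ← funext hqp] at hcoup
  calc transportCost n c p q
      ≤ ∑ t, ∑ z : 𝒳 × 𝒳, π t z * c z.1 z.2 := by
        refine (transportCost_le hc0 hcoup).trans_eq ?_
        rw [sum_mul_sum_eq_sum_cost]
        refine Finset.sum_congr rfl fun t _ => ?_
        rw [sum_prod_pair]
        exact sum_prod_mul_apply (fun i => (hπ i).1.2) t fun z : 𝒳 × 𝒳 => c z.1 z.2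
    _ ≤ ∑ t, (transportCost1 c (coordMarginal n p t) (coordMarginal n q t) + ε / n) :=
        Finset.sum_le_sum fun t _ => (hlt t).le
    _ = ∑ t, transportCost1 c (coordMarginal n p t) (coordMarginal n q t) + ε := by
        simp [Finset.sum_add_distrib, mul_div_cancel₀ ε hn'.ne']
end

section
/- Let 𝒳 be a nonempty finite set, n a positive integer, c : 𝒳 × 𝒳 → [0,∞) a cost function, and c_max = max_{x,x' ∈ 𝒳} c(x,x'). For any probability mass functions p, q, p', q' on 𝒳ⁿ, |φ(p,q) − φ(p',q')| ≤ n·c_max·(dTV(p,p') + dTV(q,q')). -/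
open Finset

/-- Total variation distance between pmfs on a finite type. -/
noncomputable def dTV {α : Type*} [Fintype α] (p q : α → ℝ) : ℝ :=
  (1 / 2) * ∑ a, |p a - q a|

/-- The maximum cost `c_max = max_{x,x'} c(x,x')`. -/
noncomputable def cMax {𝒳 : Type*} [Fintype 𝒳] [Nonempty 𝒳] (c : 𝒳 → 𝒳 → ℝ) : ℝ :=
  Finset.univ.sup' Finset.univ_nonempty (fun z : 𝒳 × 𝒳 => c z.1 z.2)

/-- A nonnegative function whose marginals are dominated by two pmfs extends to a coupling of
them, at a cost of at most `M` per unit of missing mass. -/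
theorem exists_isCoupling_extend {α : Type*} [Fintype α] {p q : α → ℝ} (hp : IsPMF p)
    (hq : IsPMF q) {d : α × α → ℝ} {M : ℝ} (hM : ∀ z, d z ≤ M) {μ : α × α → ℝ}
    (hμ : ∀ z, 0 ≤ μ z) (hμp : ∀ a, ∑ b, μ (a, b) ≤ p a) (hμq : ∀ b, ∑ a, μ (a, b) ≤ q b) :
    ∃ π, IsCoupling p q π ∧ ∑ z, π z * d z ≤ ∑ z, μ z * d z + M * (1 - ∑ z, μ z) := by
  set δ := 1 - ∑ z, μ z with hδ
  set u : α → ℝ := fun a => p a - ∑ b, μ (a, b) with hu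
  set v : α → ℝ := fun b => q b - ∑ a, μ (a, b) with hv
  have hu0 : ∀ a, 0 ≤ u a := fun a => sub_nonneg.2 (hμp a)
  have hv0 : ∀ b, 0 ≤ v b := fun b => sub_nonneg.2 (hμq b)
  have hus : ∑ a, u a = δ := by
    rw [hδ, hu, sum_sub_distrib, hp.2, Fintype.sum_prod_type]
  have hvs : ∑ b, v b = δ := by
    rw [hδ, hv, sum_sub_distrib, hq.2, Fintype.sum_prod_type_right]
  have hδ0 : 0 ≤ δ := hus ▸ sum_nonneg fun a _ => hu0 a
  have hcancel : ∀ w : α → ℝ, (∀ a, 0 ≤ w a) → ∑ a, w a = δ → ∀ a, w a * δ / δ = w a := by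
    intro w hw hws a
    refine mul_div_cancel_of_imp fun h => ?_
    exact (sum_eq_zero_iff_of_nonneg fun a _ => hw a).1 (hws.trans h) a (mem_univ a)
  have hrow : ∀ a, ∑ b, u a * v b / δ = u a := fun a => by
    rw [← sum_div, ← mul_sum, hvs, hcancel u hu0 hus]
  have hcol : ∀ b, ∑ a, u a * v b / δ = v b := fun b => by
    rw [← sum_div, ← sum_mul, hus, mul_comm, hcancel v hv0 hvs]
  have hnn : ∀ z : α × α, 0 ≤ u z.1 * v z.2 / δ := fun z =>
    div_nonneg (mul_nonneg (hu0 _) (hv0 _)) hδ0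
  have htot : ∑ z : α × α, u z.1 * v z.2 / δ = δ := by
    rw [Fintype.sum_prod_type]
    simp only [hrow, hus]
  refine ⟨fun z => μ z + u z.1 * v z.2 / δ, ⟨⟨fun z => add_nonneg (hμ z) (hnn z), ?_⟩,
    fun a => ?_, fun b => ?_⟩, ?_⟩
  · rw [sum_add_distrib, htot, hδ]
    ring
  · rw [sum_add_distrib, hrow, hu]
    ring
  · rw [sum_add_distrib, hcol, hv]
    ring
  · simp only [add_mul, sum_add_distrib]
    gcongr
    calc ∑ z : α × α, u z.1 * v z.2 / δ * d z
        ≤ ∑ z : α × α, u z.1 * v z.2 / δ * M :=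
          sum_le_sum fun z _ => mul_le_mul_of_nonneg_left (hM z) (hnn z)
      _ = M * δ := by rw [← sum_mul, htot, mul_comm]

theorem dTV_comm {α : Type*} [Fintype α] (p q : α → ℝ) : dTV p q = dTV q p := by
  simp only [dTV, abs_sub_comm]

theorem IsPMF.sum_sub_min_eq_dTV {α : Type*} [Fintype α] {p p' : α → ℝ} (hp : IsPMF p)
    (hp' : IsPMF p') : ∑ a, (p a - min (p a) (p' a)) = dTV p p' := by
  have h : ∀ a, p a - min (p a) (p' a) = 1 / 2 * |p a - p' a| + 1 / 2 * (p a - p' a) := by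
    intro a
    rcases le_total (p a) (p' a) with h | h
    · rw [min_eq_left h, abs_of_nonpos (sub_nonpos.2 h)]
      ring
    · rw [min_eq_right h, abs_of_nonneg (sub_nonneg.2 h)]
      ring
  simp only [h, sum_add_distrib, ← mul_sum, sum_sub_distrib, hp.2, hp'.2, dTV]
  ring

/-- The fraction of the mass of a pmf that a second pmf can retain at each point. -/
theorem IsPMF.exists_retention {α : Type*} [Fintype α] {p p' : α → ℝ} (hp : IsPMF p)
    (hp' : IsPMF p') : ∃ r : α → ℝ, (∀ a, 0 ≤ r a) ∧ (∀ a, r a ≤ 1) ∧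
      (∀ a, p a * r a ≤ p' a) ∧ ∑ a, p a * (1 - r a) = dTV p p' := by
  have h : ∀ a, p a * (min (p a) (p' a) / p a) = min (p a) (p' a) := fun a =>
    mul_div_cancel_of_imp' fun h => by rw [h, min_eq_left (hp'.1 a)]
  refine ⟨fun a => min (p a) (p' a) / p a, fun a => div_nonneg (le_min (hp.1 a) (hp'.1 a)) (hp.1 a),
    fun a => div_le_one_of_le₀ (min_le_left _ _) (hp.1 a), fun a => ?_, ?_⟩
  · exact (h a).trans_le (min_le_right _ _)
  · simp only [mul_sub, mul_one, h]
    exact hp.sum_sub_min_eq_dTV hp'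

/-- A coupling can be transferred to nearby marginals at a cost controlled by total variation. -/
theorem IsCoupling.exists_transfer {α : Type*} [Fintype α] {p q p' q' : α → ℝ} (hp : IsPMF p)
    (hq : IsPMF q) (hp' : IsPMF p') (hq' : IsPMF q') {d : α × α → ℝ} {M : ℝ}
    (hd : ∀ z, 0 ≤ d z) (hM0 : 0 ≤ M) (hM : ∀ z, d z ≤ M) {π : α × α → ℝ}
    (hπ : IsCoupling p q π) :
    ∃ π', IsCoupling p' q' π' ∧
      ∑ z, π' z * d z ≤ ∑ z, π z * d z + M * (dTV p p' + dTV q q') := by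
  obtain ⟨⟨hπ0, hπ1⟩, hπp, hπq⟩ := hπ
  obtain ⟨r, hr0, hr1, hrp, hrs⟩ := hp.exists_retention hp'
  obtain ⟨s, hs0, hs1, hsq, hss⟩ := hq.exists_retention hq'
  obtain ⟨π', hπ', hle⟩ := exists_isCoupling_extend hp' hq' hM
    (μ := fun z => π z * (r z.1 * s z.2))
    (fun z => mul_nonneg (hπ0 z) (mul_nonneg (hr0 _) (hs0 _)))
    (fun a => by
      refine le_trans ?_ (hrp a)
      rw [← hπp a, sum_mul]
      exact sum_le_sum fun b _ => mul_le_mul_of_nonneg_left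
        (mul_le_of_le_one_right (hr0 a) (hs1 b)) (hπ0 _))
    (fun b => by
      refine le_trans ?_ (hsq b)
      rw [← hπq b, sum_mul]
      exact sum_le_sum fun a _ => mul_le_mul_of_nonneg_left
        (mul_le_of_le_one_left (hs0 b) (hr1 a)) (hπ0 _))
  refine ⟨π', hπ', hle.trans (add_le_add (sum_le_sum fun z _ => ?_)
    (mul_le_mul_of_nonneg_left ?_ hM0))⟩
  · exact mul_le_mul_of_nonneg_right (mul_le_of_le_one_right (hπ0 z)
      (mul_le_one₀ (hr1 _) (hs0 _) (hs1 _))) (hd z)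
  · have hrow : ∑ z : α × α, π z * (1 - r z.1) = dTV p p' := by
      rw [← hrs, Fintype.sum_prod_type]
      simp only [← sum_mul, hπp]
    have hcol : ∑ z : α × α, π z * (1 - s z.2) = dTV q q' := by
      rw [← hss, Fintype.sum_prod_type_right]
      simp only [← sum_mul, hπq]
    rw [← hπ1, ← sum_sub_distrib, ← hrow, ← hcol, ← sum_add_distrib]
    refine sum_le_sum fun z _ => ?_
    nlinarith [mul_nonneg (hπ0 z)
      (mul_nonneg (sub_nonneg.2 (hr1 z.1)) (sub_nonneg.2 (hs1 z.2)))]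

theorem transportCost_le_add {𝒳 : Type*} [Fintype 𝒳] [Nonempty 𝒳] (n : ℕ) {c : 𝒳 → 𝒳 → ℝ}
    (hc : ∀ x y, 0 ≤ c x y) {p q p' q' : (Fin n → 𝒳) → ℝ}
    (hp : IsPMF p) (hq : IsPMF q) (hp' : IsPMF p') (hq' : IsPMF q') :
    transportCost n c p' q' ≤
      transportCost n c p q + (n : ℝ) * cMax c * (dTV p p' + dTV q q') := by
  have hle : ∀ x y, c x y ≤ cMax c := fun x y =>
    le_sup' (fun z : 𝒳 × 𝒳 => c z.1 z.2) (mem_univ (x, y))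
  have hd0 : ∀ z : (Fin n → 𝒳) × (Fin n → 𝒳), 0 ≤ ∑ t, c (z.1 t) (z.2 t) := fun z =>
    sum_nonneg fun t _ => hc _ _
  have hdM : ∀ z : (Fin n → 𝒳) × (Fin n → 𝒳), ∑ t, c (z.1 t) (z.2 t) ≤ n * cMax c := fun z =>
    (sum_le_sum fun t _ => hle _ _).trans_eq (by simp)
  have hM0 : 0 ≤ (n : ℝ) * cMax c := by
    obtain ⟨x⟩ := ‹Nonempty 𝒳›
    exact mul_nonneg n.cast_nonneg ((hc x x).trans (hle x x))
  rw [← sub_le_iff_le_add]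
  refine le_csInf ?_ ?_
  · obtain ⟨π, hπ, -⟩ := exists_isCoupling_extend hp hq hdM (μ := 0) (fun _ => le_rfl)
      (fun a => by simpa using hp.1 a) (fun b => by simpa using hq.1 b)
    exact ⟨_, π, hπ, rfl⟩
  · rintro _ ⟨π, hπ, rfl⟩
    obtain ⟨π', hπ', h⟩ := hπ.exists_transfer hp hq hp' hq' hd0 hM0 hdM
    rw [sub_le_iff_le_add]
    refine le_trans (csInf_le ⟨0, ?_⟩ ⟨π', hπ', rfl⟩) h
    rintro _ ⟨σ, hσ, rfl⟩
    exact sum_nonneg fun z _ => mul_nonneg (hσ.1.1 z) (hd0 z)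

/-- Continuity of the transport divergence with respect to total variation distance:
`|φ(p,q) − φ(p',q')| ≤ n·c_max·(dTV(p,p') + dTV(q,q'))`. -/
theorem transportCost_continuity {𝒳 : Type*} [Fintype 𝒳] [Nonempty 𝒳]
    (n : ℕ) (hn : 0 < n) (c : 𝒳 → 𝒳 → ℝ)
    (hc0 : ∀ x y, 0 ≤ c x y) (hcz : ∀ x y, c x y = 0 ↔ x = y)
    (p q p' q' : (Fin n → 𝒳) → ℝ)
    (hp : IsPMF p) (hq : IsPMF q) (hp' : IsPMF p') (hq' : IsPMF q') :
    |transportCost n c p q - transportCost n c p' q'|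
      ≤ (n : ℝ) * cMax c * (dTV p p' + dTV q q') := by
  have h₁ := transportCost_le_add n hc0 hp hq hp' hq'
  have h₂ := transportCost_le_add n hc0 hp' hq' hp hq
  rw [dTV_comm p' p, dTV_comm q' q] at h₂
  exact abs_sub_le_iff.2 ⟨by linarith, by linarith⟩
end

section
/- For every D ≥ 0 and P ≥ 0, the value ħ(D,P) is the greatest element of the set { H_b(a) : a, â ∈ [0,1], (1−a)·â + a·(1−â) ≤ D, |a − â| ≤ P }. In particular, the maximum of H_b(a) over this constraint set is attained and equals ħ(D,P). -/
/-- The binary entropy function (natural logarithm, `Real.log 0 = 0`). -/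
noncomputable def Hb (a : ℝ) : ℝ :=
  -(a * Real.log a) - (1 - a) * Real.log (1 - a)

/-- The function `ħ(D,P)` from the paper. -/
noncomputable def hbar (D P : ℝ) : ℝ :=
  if D < 1 / 2 then
    Hb ((1 + min D P - Real.sqrt (1 + (min D P) ^ 2 - 2 * D)) / 2)
  else Real.log 2

theorem Hb_eq_binEntropy (a : ℝ) : Hb a = Real.binEntropy a := by
  simp only [Hb, Real.binEntropy, Real.log_inv]
  ring

/-- In the lower half of the constraint set, `a` is at least the explicit optimizer. -/
theorem optimizer_le {D P a b : ℝ} (hP : 0 ≤ P) (hD : 0 ≤ D)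
    (ha : a < 1 / 2) (hb : 0 ≤ b) (h : (1 - a) * b + a * (1 - b) ≤ D) (hab : a - b ≤ P) :
    a ≤ (1 + min D P - Real.sqrt (1 + (min D P) ^ 2 - 2 * D)) / 2 := by
  suffices hs : Real.sqrt (1 + (min D P) ^ 2 - 2 * D) ≤ 1 - 2 * a + min D P by linarith
  have hm : 0 ≤ min D P := le_min hD hP
  refine Real.sqrt_le_iff.2 ⟨by linarith, ?_⟩
  rcases le_total D P with hle | hle
  · rw [min_eq_left hle]
    have haD : a ≤ D := by nlinarith
    nlinarith
  · rw [min_eq_right hle]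
    nlinarith

/-- The explicit optimizer and its partner are feasible, and the optimizer is at most `1/2`. -/
theorem optimizer_feasible {D m : ℝ} (hmD : m ≤ D) (hD : D < 1 / 2) :
    let a := (1 + m - Real.sqrt (1 + m ^ 2 - 2 * D)) / 2
    0 ≤ a - m ∧ a ≤ 1 / 2 ∧ (1 - a) * (a - m) + a * (1 - (a - m)) = D := by
  intro a
  have hle : Real.sqrt (1 + m ^ 2 - 2 * D) ≤ 1 - m :=
    Real.sqrt_le_iff.2 ⟨by linarith, by nlinarith⟩
  have hge : m ≤ Real.sqrt (1 + m ^ 2 - 2 * D) := Real.le_sqrt_of_sq_le (by linarith)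
  have hsq : Real.sqrt (1 + m ^ 2 - 2 * D) ^ 2 = 1 + m ^ 2 - 2 * D :=
    Real.sq_sqrt (by nlinarith)
  refine ⟨by simp only [a]; linarith, by simp only [a]; linarith, ?_⟩
  simp only [a]
  linear_combination -hsq / 2

/-- `ħ(D,P)` is the greatest element of the set of binary entropies `H_b(a)` over
`a, â ∈ [0,1]` with `(1−a)·â + a·(1−â) ≤ D` and `|a − â| ≤ P`. -/
theorem hbar_isGreatest (D P : ℝ) (hD : 0 ≤ D) (hP : 0 ≤ P) :
    IsGreatest
      { v | ∃ a ahat : ℝ, a ∈ Set.Icc (0 : ℝ) 1 ∧ ahat ∈ Set.Icc (0 : ℝ) 1 ∧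
        (1 - a) * ahat + a * (1 - ahat) ≤ D ∧ |a - ahat| ≤ P ∧ v = Hb a }
      (hbar D P) := by
  by_cases hD' : D < 1 / 2
  · rw [hbar, if_pos hD']
    have hm : 0 ≤ min D P := le_min hD hP
    obtain ⟨h0, h1, h2⟩ := optimizer_feasible (min_le_left D P) hD'
    refine ⟨⟨_, _, ⟨by linarith, by linarith⟩, ⟨h0, by linarith⟩, h2.le, ?_, rfl⟩, ?_⟩
    · rw [sub_sub_cancel, abs_of_nonneg hm]
      exact min_le_right D P
    · rintro v ⟨a, b, ⟨ha0, ha1⟩, ⟨hb0, hb1⟩, h, hab, rfl⟩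
      obtain ⟨hab1, hab2⟩ := abs_le.1 hab
      rw [Hb_eq_binEntropy, Hb_eq_binEntropy]
      have hmem : (1 + min D P - Real.sqrt (1 + (min D P) ^ 2 - 2 * D)) / 2 ∈
          Set.Icc (0 : ℝ) 2⁻¹ := ⟨by linarith, by linarith⟩
      have hmono := Real.binEntropy_strictMonoOn.monotoneOn
      rcases lt_trichotomy a (1 / 2) with hlt | rfl | hgt
      · exact hmono ⟨ha0, by linarith⟩ hmem (optimizer_le hP hD hlt hb0 h hab2)
      · linarith
      · rw [← Real.binEntropy_one_sub a]
        refine hmono ⟨by linarith, by linarith⟩ hmem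
          (optimizer_le (b := 1 - b) hP hD (by linarith) (by linarith) ?_ (by linarith))
        linarith
  · rw [hbar, if_neg hD']
    refine ⟨⟨1 / 2, 1 / 2, by norm_num, by norm_num, by linarith, by simpa using hP, ?_⟩, ?_⟩
    · rw [Hb_eq_binEntropy, one_div, Real.binEntropy_two_inv]
    · rintro v ⟨a, b, -, -, -, -, rfl⟩
      rw [Hb_eq_binEntropy]
      exact Real.binEntropy_le_log_two
end

section
/- The function ħ is neither concave nor convex on [0,∞) × [0,∞): it is not the case that ħ is concave on {(D,P) : D ≥ 0, P ≥ 0}, and it is not the case that ħ is convex on {(D,P) : D ≥ 0, P ≥ 0}. -/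
theorem Hb_quarter : Hb (1 / 4) = 2 * Real.log 2 - 3 / 4 * Real.log 3 := by
  have h4 : Real.log 4 = 2 * Real.log 2 := by
    rw [show (4 : ℝ) = 2 ^ 2 by norm_num, Real.log_pow]; norm_num
  rw [Hb, show (1 : ℝ) - 1 / 4 = 3 / 4 by norm_num,
    Real.log_div (by norm_num) (by norm_num), Real.log_div (by norm_num) (by norm_num),
    h4, Real.log_one]
  ring

theorem Hb_five_sixteenths :
    Hb (5 / 16) = 4 * Real.log 2 - 5 / 16 * Real.log 5 - 11 / 16 * Real.log 11 := by
  have h16 : Real.log 16 = 4 * Real.log 2 := by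
    rw [show (16 : ℝ) = 2 ^ 4 by norm_num, Real.log_pow]; norm_num
  rw [Hb, show (1 : ℝ) - 5 / 16 = 11 / 16 by norm_num,
    Real.log_div (by norm_num) (by norm_num), Real.log_div (by norm_num) (by norm_num), h16]
  ring

theorem two_mul_Hb_five_sixteenths_lt : 2 * Hb (5 / 16) < Hb (1 / 4) + Real.log 2 := by
  have h : Real.log (2 ^ 40 * 3 ^ 6) < Real.log (5 ^ 5 * 11 ^ 11) :=
    Real.log_lt_log (by norm_num) (by norm_num)
  rw [Real.log_mul (by norm_num) (by norm_num), Real.log_mul (by norm_num) (by norm_num)] at h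
  simp only [Real.log_pow] at h
  push_cast at h
  rw [Hb_five_sixteenths, Hb_quarter]
  linarith

theorem hbar_of_half_le {D : ℝ} (hD : 1 / 2 ≤ D) (P : ℝ) : hbar D P = Real.log 2 :=
  if_neg hD.not_gt

/-- Evaluation of `hbar` where `P ≤ D < 1 / 2`, given the value `s` of the square root. -/
theorem hbar_eq_Hb {D P s : ℝ} (hD : D < 1 / 2) (hP : P ≤ D) (hs : 0 ≤ s)
    (h : 1 + P ^ 2 - 2 * D = s ^ 2) : hbar D P = Hb ((1 + P - s) / 2) := by
  rw [hbar, if_pos hD, min_eq_right hP, h, Real.sqrt_sq hs]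

/-- `ħ` is neither concave nor convex on `[0,∞) × [0,∞)`. -/
theorem hbar_not_concaveOn_not_convexOn :
    ¬ ConcaveOn ℝ (Set.Ici (0 : ℝ) ×ˢ Set.Ici (0 : ℝ)) (fun z : ℝ × ℝ => hbar z.1 z.2) ∧
    ¬ ConvexOn ℝ (Set.Ici (0 : ℝ) ×ˢ Set.Ici (0 : ℝ)) (fun z : ℝ × ℝ => hbar z.1 z.2) := by
  constructor
  · intro hc
    have key := hc.2 (show ((5 / 16, 1 / 8) : ℝ × ℝ) ∈ _ by norm_num) (show ((1 / 2, 0) : ℝ × ℝ) ∈ _ by simp)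
      (show (0 : ℝ) ≤ 1 / 2 by norm_num) (show (0 : ℝ) ≤ 1 / 2 by norm_num) (by norm_num)
    simp only [Prod.fst_add, Prod.snd_add, Prod.smul_fst, Prod.smul_snd, smul_eq_mul] at key
    norm_num only at key
    rw [hbar_of_half_le le_rfl, hbar_eq_Hb (s := 5 / 8) (by norm_num) (by norm_num) (by norm_num)
      (by norm_num), hbar_eq_Hb (s := 7 / 16) (by norm_num) (by norm_num) (by norm_num)
      (by norm_num)] at key
    norm_num only at key
    linarith [two_mul_Hb_five_sixteenths_lt]
  · intro hc
    have key := hc.2 (show ((0, 0) : ℝ × ℝ) ∈ _ by simp) (show ((1, 0) : ℝ × ℝ) ∈ _ by simp)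
      (show (0 : ℝ) ≤ 1 / 2 by norm_num) (show (0 : ℝ) ≤ 1 / 2 by norm_num) (by norm_num)
    simp only [Prod.fst_add, Prod.snd_add, Prod.smul_fst, Prod.smul_snd, smul_eq_mul] at key
    norm_num only at key
    have h0 : hbar 0 0 = 0 := by
      rw [hbar_eq_Hb (s := 1) (by norm_num) le_rfl (by norm_num) (by norm_num)]
      norm_num [Hb]
    rw [h0, hbar_of_half_le le_rfl, hbar_of_half_le (by norm_num)] at key
    linarith [Real.log_pos one_lt_two]
end

section
/- The function ħ is nondecreasing in each argument: for all 0 ≤ D ≤ D' and 0 ≤ P ≤ P', ħ(D,P) ≤ ħ(D',P'). -/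
theorem Hb_le_log_two (a : ℝ) : Hb a ≤ Real.log 2 :=
  Hb_eq_binEntropy a ▸ Real.binEntropy_le_log_two

theorem Hb_le_Hb {a b : ℝ} (ha : 0 ≤ a) (hab : a ≤ b) (hb : b ≤ 1 / 2) : Hb a ≤ Hb b := by
  rw [Hb_eq_binEntropy, Hb_eq_binEntropy]
  rw [one_div] at hb
  exact Real.binEntropy_strictMonoOn.monotoneOn ⟨ha, hab.trans hb⟩ ⟨ha.trans hab, hb⟩ hab

theorem le_sqrt_one_add_sq_sub {m D : ℝ} (hD : D ≤ 1 / 2) :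
    m ≤ Real.sqrt (1 + m ^ 2 - 2 * D) :=
  Real.le_sqrt_of_sq_le (by linarith)

theorem sqrt_one_add_sq_sub_le {m D : ℝ} (hm : 0 ≤ m) (hD : 0 ≤ D) :
    Real.sqrt (1 + m ^ 2 - 2 * D) ≤ 1 + m :=
  Real.sqrt_le_iff.2 ⟨by linarith, by linarith [add_sq 1 m]⟩

theorem sub_sqrt_one_add_sq_sub_mono {m m' D D' : ℝ} (hD : D ≤ 1 / 2) (hm : m ≤ m')
    (hDD' : D ≤ D') :
    m - Real.sqrt (1 + m ^ 2 - 2 * D) ≤ m' - Real.sqrt (1 + m' ^ 2 - 2 * D') := by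
  have hs : m ≤ Real.sqrt (1 + m ^ 2 - 2 * D) := le_sqrt_one_add_sq_sub hD
  have hsq : Real.sqrt (1 + m ^ 2 - 2 * D) ^ 2 = 1 + m ^ 2 - 2 * D :=
    Real.sq_sqrt (by linarith [sq_nonneg m])
  have h : Real.sqrt (1 + m' ^ 2 - 2 * D') ≤
      Real.sqrt (1 + m ^ 2 - 2 * D) + (m' - m) :=
    Real.sqrt_le_iff.2 ⟨by linarith [Real.sqrt_nonneg (1 + m ^ 2 - 2 * D)],
      by nlinarith [mul_nonneg (sub_nonneg.2 hs) (sub_nonneg.2 hm)]⟩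
  linarith

/-- `ħ` is nondecreasing in each argument on `[0,∞)²`. -/
theorem hbar_monotone (D D' P P' : ℝ) (hD : 0 ≤ D) (hDD' : D ≤ D')
    (hP : 0 ≤ P) (hPP' : P ≤ P') : hbar D P ≤ hbar D' P' := by
  unfold hbar
  by_cases h' : D' < 1 / 2
  · have h : D < 1 / 2 := hDD'.trans_lt h'
    rw [if_pos h, if_pos h']
    have hm : min D P ≤ min D' P' := min_le_min hDD' hPP'
    have h0 := sqrt_one_add_sq_sub_le (le_min hD hP) hD
    have h1 := sub_sqrt_one_add_sq_sub_mono h.le hm hDD'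
    have h2 : min D' P' ≤ _ := le_sqrt_one_add_sq_sub h'.le
    exact Hb_le_Hb (by linarith) (by linarith) (by linarith)
  · rw [if_neg h']
    split_ifs
    · exact Hb_le_log_two _
    · exact le_rfl
end

section
/- Let L be a positive integer, σ_ℓ² > 0 for ℓ ∈ {1,…,L}, D > 0, and P ≥ 0. Define D* = (D + √((2D − min(D,P))·min(D,P)))/2 and α = ((D − √((2D−P)·P))/(D−P))² if D > P, α = 0 if D ≤ P. Suppose either (a) D* < ∑_ℓ σ_ℓ² and ω > 0 satisfies ∑_ℓ min(ω, σ_ℓ²) = D*, in which case set ω_ℓ = min(ω, σ_ℓ²); or (b) D* ≥ ∑_ℓ σ_ℓ², in which case set ω_ℓ = σ_ℓ². Then: (1) the point γ_ℓ = ω_ℓ, γ̂_ℓ = α·ω_ℓ is feasible, i.e. 0 < γ_ℓ ≤ σ_ℓ², γ̂_ℓ ≥ 0, ∑_ℓ (γ_ℓ + γ̂_ℓ) ≤ D, and ∑_ℓ (√γ_ℓ − √γ̂_ℓ)² ≤ P, and its objective value is −∑_ℓ (1/2)·log(2πe·ω_ℓ); (2) for every (γ_ℓ, γ̂_ℓ)_{ℓ=1}^L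 with 0 < γ_ℓ ≤ σ_ℓ², γ̂_ℓ ≥ 0, ∑_ℓ (γ_ℓ + γ̂_ℓ) ≤ D, and ∑_ℓ (√γ_ℓ − √γ̂_ℓ)² ≤ P, one has −∑_ℓ (1/2)·log(2πe·γ_ℓ) ≥ −∑_ℓ (1/2)·log(2πe·ω_ℓ); and (3) in case (a), ω is the unique positive solution of ∑_ℓ min(ω, σ_ℓ²) = D*. -/
open Finset Real

/-- The total water level `Dstar` and the ratio `α = β ^ 2` make both constraints tight when
`P < D`, and `β = 0` otherwise. -/
lemma exists_sqrt_ratio {D P Dstar α : ℝ} (hD : 0 < D) (hP : 0 ≤ P)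
    (hDstar : Dstar = (D + √((2 * D - min D P) * min D P)) / 2)
    (hα : α = if P < D then ((D - √((2 * D - P) * P)) / (D - P)) ^ 2 else 0) :
    ∃ β : ℝ, 0 ≤ β ∧ β ≤ 1 ∧ α = β ^ 2 ∧ Dstar * (1 + β ^ 2) = D ∧
      Dstar * (1 - β) ^ 2 ≤ P ∧ (1 - β) * D + β * P = (1 - β ^ 2) * Dstar ∧
      (β = 1 → P = 0) := by
  by_cases h : P < D
  · rw [if_pos h] at hα
    rw [min_eq_right h.le] at hDstar
    set s := √((2 * D - P) * P) with hs
    have hs2 : s ^ 2 = (2 * D - P) * P := Real.sq_sqrt (by nlinarith)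
    have hs0 : 0 ≤ s := Real.sqrt_nonneg _
    have hPs : P ≤ s := Real.le_sqrt_of_sq_le (by nlinarith)
    have hsD : s ≤ D := abs_le_of_sq_le_sq' (by nlinarith [sq_nonneg (D - P)]) hD.le |>.2
    have hDP : 0 < D - P := sub_pos.2 h
    obtain ⟨β, hβ⟩ : ∃ β, β = (D - s) / (D - P) := ⟨_, rfl⟩
    have hβm : β * (D - P) = D - s := by rw [hβ]; field_simp
    have hβs : (D + s) * β = D - P := by
      apply mul_right_cancel₀ hDP.ne'
      linear_combination (D + s) * hβm - hs2
    have hβ2 : (D + s) * β ^ 2 = D - s := by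
      linear_combination β * hβs + hβm
    refine ⟨β, hβ ▸ div_nonneg (by linarith) hDP.le, ?_, by rw [hα, hβ], ?_, ?_, ?_, ?_⟩
    · rw [hβ, div_le_one hDP]; linarith
    · rw [hDstar]; linear_combination hβ2 / 2
    · rw [hDstar]; apply le_of_eq; linear_combination hβ2 / 2 - hβs
    · rw [hDstar]; linear_combination hβ2 / 2 - hβm
    · intro h1
      have : s = P := by rw [h1] at hβm; linarith
      rw [this] at hs2
      have : P * (D - P) = 0 := by linarith
      exact (mul_eq_zero.1 this).resolve_right hDP.ne'
  · rw [if_neg h] at hα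
    have h' := not_lt.1 h
    rw [min_eq_left h', show (2 * D - D) * D = D ^ 2 by ring, Real.sqrt_sq hD.le] at hDstar
    exact ⟨0, le_rfl, zero_le_one, by simp [hα], by rw [hDstar]; ring, by linarith,
      by rw [hDstar]; ring, by simp⟩

/-- Under both constraints, the total of `γ` is bounded by the total water level. -/
lemma sum_le_of_distortion_perception {ι : Type*} [Fintype ι] {D P Dstar β : ℝ}
    (h0 : 0 ≤ β) (h1 : β ≤ 1) (hDs : Dstar * (1 + β ^ 2) = D)
    (hdual : (1 - β) * D + β * P = (1 - β ^ 2) * Dstar) (hP0 : β = 1 → P = 0)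
    {γ γhat : ι → ℝ} (hγ : ∀ i, 0 ≤ γ i) (hγhat : ∀ i, 0 ≤ γhat i)
    (hsum : ∑ i, (γ i + γhat i) ≤ D)
    (hperc : ∑ i, (√(γ i) - √(γhat i)) ^ 2 ≤ P) : ∑ i, γ i ≤ Dstar := by
  rcases h1.lt_or_eq with h1 | rfl
  · have key : (1 - β ^ 2) * ∑ i, γ i ≤
        (1 - β) * ∑ i, (γ i + γhat i) + β * ∑ i, (√(γ i) - √(γhat i)) ^ 2 := by
      rw [mul_sum, mul_sum, mul_sum, ← sum_add_distrib]
      refine sum_le_sum fun i _ => ?_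
      have hu := Real.sq_sqrt (hγ i)
      have hv := Real.sq_sqrt (hγhat i)
      nlinarith [sq_nonneg (√(γhat i) - β * √(γ i))]
    have hc : 0 < 1 - β ^ 2 := by nlinarith
    refine le_of_mul_le_mul_left ?_ hc
    have h2 := mul_le_mul_of_nonneg_left hsum (sub_nonneg.2 h1.le)
    have h3 := mul_le_mul_of_nonneg_left hperc h0
    linarith
  · have hz := (sum_eq_zero_iff_of_nonneg (fun i _ => sq_nonneg (√(γ i) - √(γhat i)))).1
      (le_antisymm (hperc.trans_eq (hP0 rfl)) (sum_nonneg fun i _ => sq_nonneg _))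
    have he : ∀ i, γhat i = γ i := fun i =>
      ((Real.sqrt_inj (hγ i) (hγhat i)).1 (sub_eq_zero.1 (pow_eq_zero_iff two_ne_zero |>.1
        (hz i (mem_univ i))))).symm
    simp only [he, sum_add_distrib] at hsum
    linarith

/-- Optimality of water-filling for the sum of logarithms. -/
lemma sum_log_le_sum_log_min {ι : Type*} [Fintype ι] {ω : ℝ} (hω : 0 < ω) {σsq γ : ι → ℝ}
    (hγ : ∀ i, 0 < γ i) (hγσ : ∀ i, γ i ≤ σsq i)
    (hsum : ∑ i, γ i ≤ ∑ i, min ω (σsq i)) :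
    ∑ i, log (γ i) ≤ ∑ i, log (min ω (σsq i)) := by
  have key : ∀ i, log (γ i) - log (min ω (σsq i)) ≤ (γ i - min ω (σsq i)) / ω := by
    intro i
    have hm : 0 < min ω (σsq i) := lt_min hω ((hγ i).trans_le (hγσ i))
    have h := Real.log_le_sub_one_of_pos (div_pos (hγ i) hm)
    rw [Real.log_div (hγ i).ne' hm.ne', ← div_self hm.ne', ← sub_div] at h
    refine h.trans ?_
    rcases le_total ω (σsq i) with hle | hle
    · rw [min_eq_left hle]
    · rw [min_eq_right hle] at hm ⊢
      rw [div_le_div_iff₀ hm hω]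
      exact mul_le_mul_of_nonpos_left hle (sub_nonpos.2 (hγσ i))
  have h := sum_le_sum fun i (_ : i ∈ univ) => key i
  rw [← sum_div, sum_sub_distrib, sum_sub_distrib] at h
  have := div_nonpos_of_nonpos_of_nonneg (sub_nonpos.2 hsum) hω.le
  linarith

/-- Below saturation, the water-filling total is strictly increasing in the level. -/
lemma sum_min_lt_sum_min {ι : Type*} [Fintype ι] {σsq : ι → ℝ} {a b : ℝ} (hab : a < b)
    (ha : ∑ i, min a (σsq i) < ∑ i, σsq i) : ∑ i, min a (σsq i) < ∑ i, min b (σsq i) := by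
  obtain ⟨i, -, hi⟩ := exists_lt_of_sum_lt ha
  have hai : a < σsq i := (min_lt_iff.1 hi).resolve_right (lt_irrefl _)
  exact sum_lt_sum (fun j _ => min_le_min_right _ hab.le)
    ⟨i, mem_univ i, (min_le_left _ _).trans_lt (lt_min hab hai)⟩

/-- Solution of the optimization problem in the extended Shannon lower bound
(Lemma on `χ(D,P)`): feasibility and optimality of the reverse water-filling point,
together with uniqueness of the water level. -/
theorem chi_optimization (L : ℕ) (hL : 0 < L) (σsq : Fin L → ℝ) (hσ : ∀ ℓ, 0 < σsq ℓ)
    (D P : ℝ) (hD : 0 < D) (hP : 0 ≤ P)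
    (Dstar : ℝ)
    (hDstar : Dstar = (D + Real.sqrt ((2 * D - min D P) * min D P)) / 2)
    (α : ℝ)
    (hα : α = if P < D then ((D - Real.sqrt ((2 * D - P) * P)) / (D - P)) ^ 2 else 0)
    (ω : ℝ) (ωl : Fin L → ℝ)
    (hcase :
      (Dstar < (∑ ℓ, σsq ℓ) ∧ 0 < ω ∧ (∑ ℓ, min ω (σsq ℓ)) = Dstar ∧
        ωl = fun ℓ => min ω (σsq ℓ)) ∨
      ((∑ ℓ, σsq ℓ) ≤ Dstar ∧ ωl = σsq)) :
    -- (1) the point `γ = ωl`, `γ̂ = α·ωl` is feasible with objective value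
    --     `−∑ (1/2)·log(2πe·ωl ℓ)`
    ((∀ ℓ, 0 < ωl ℓ ∧ ωl ℓ ≤ σsq ℓ ∧ 0 ≤ α * ωl ℓ) ∧
      (∑ ℓ, (ωl ℓ + α * ωl ℓ)) ≤ D ∧
      (∑ ℓ, (Real.sqrt (ωl ℓ) - Real.sqrt (α * ωl ℓ)) ^ 2) ≤ P ∧
      -(∑ ℓ, (1 / 2) * Real.log (2 * π * Real.exp 1 * ωl ℓ)) =
        -(∑ ℓ, (1 / 2) * Real.log (2 * π * Real.exp 1 * ωl ℓ))) ∧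
    -- (2) every feasible point has objective value at least `−∑ (1/2)·log(2πe·ωl ℓ)`
    (∀ γ γhat : Fin L → ℝ,
      (∀ ℓ, 0 < γ ℓ) → (∀ ℓ, γ ℓ ≤ σsq ℓ) → (∀ ℓ, 0 ≤ γhat ℓ) →
      (∑ ℓ, (γ ℓ + γhat ℓ)) ≤ D →
      (∑ ℓ, (Real.sqrt (γ ℓ) - Real.sqrt (γhat ℓ)) ^ 2) ≤ P →
      -(∑ ℓ, (1 / 2) * Real.log (2 * π * Real.exp 1 * ωl ℓ)) ≤
        -(∑ ℓ, (1 / 2) * Real.log (2 * π * Real.exp 1 * γ ℓ))) ∧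
    -- (3) in case (a), `ω` is the unique positive solution of `∑ min(ω, σ_ℓ²) = D*`
    (Dstar < (∑ ℓ, σsq ℓ) →
      ∀ ω' : ℝ, 0 < ω' → (∑ ℓ, min ω' (σsq ℓ)) = Dstar → ω' = ω) := by
  obtain ⟨β, h0, h1, hαβ, hDs, hPs, hdual, hP0⟩ := exists_sqrt_ratio hD hP hDstar hα
  have hpos : ∀ ℓ, 0 < ωl ℓ ∧ ωl ℓ ≤ σsq ℓ := by
    rcases hcase with ⟨-, hω, -, rfl⟩ | ⟨-, rfl⟩
    · exact fun ℓ => ⟨lt_min hω (hσ ℓ), min_le_right _ _⟩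
    · exact fun ℓ => ⟨hσ ℓ, le_rfl⟩
  have htot : ∑ ℓ, ωl ℓ ≤ Dstar := by
    rcases hcase with ⟨-, -, h, rfl⟩ | ⟨h, rfl⟩
    exacts [h.le, h]
  refine ⟨⟨fun ℓ => ⟨(hpos ℓ).1, (hpos ℓ).2, ?_⟩, ?_, ?_, rfl⟩, ?_, ?_⟩
  · exact hαβ ▸ mul_nonneg (sq_nonneg β) (hpos ℓ).1.le
  · calc ∑ ℓ, (ωl ℓ + α * ωl ℓ) = (∑ ℓ, ωl ℓ) * (1 + β ^ 2) := by
          rw [sum_mul, hαβ]; exact sum_congr rfl fun ℓ _ => by ring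
      _ ≤ Dstar * (1 + β ^ 2) := mul_le_mul_of_nonneg_right htot (by positivity)
      _ = D := hDs
  · calc ∑ ℓ, (√(ωl ℓ) - √(α * ωl ℓ)) ^ 2 = (∑ ℓ, ωl ℓ) * (1 - β) ^ 2 := by
          rw [sum_mul, hαβ]
          refine sum_congr rfl fun ℓ _ => ?_
          rw [Real.sqrt_mul (sq_nonneg β), Real.sqrt_sq h0]
          linear_combination (1 - β) ^ 2 * Real.sq_sqrt (hpos ℓ).1.le
      _ ≤ Dstar * (1 - β) ^ 2 := mul_le_mul_of_nonneg_right htot (sq_nonneg _)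
      _ ≤ P := hPs
  · intro γ γhat hγ hγσ hγhat hsum hperc
    have hA := sum_le_of_distortion_perception h0 h1 hDs hdual hP0 (fun ℓ => (hγ ℓ).le) hγhat
      hsum hperc
    have hlog : ∑ ℓ, log (γ ℓ) ≤ ∑ ℓ, log (ωl ℓ) := by
      rcases hcase with ⟨-, hω, h, rfl⟩ | ⟨-, rfl⟩
      · exact sum_log_le_sum_log_min hω hγ hγσ (hA.trans_eq h.symm)
      · exact sum_le_sum fun ℓ _ => Real.log_le_log (hγ ℓ) (hγσ ℓ)
    have hc : 2 * π * Real.exp 1 ≠ 0 := by positivity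
    have hsplit : ∀ f : Fin L → ℝ, (∀ ℓ, 0 < f ℓ) →
        ∑ ℓ, (1 / 2) * Real.log (2 * π * Real.exp 1 * f ℓ) =
          (1 / 2) * (∑ _ℓ : Fin L, Real.log (2 * π * Real.exp 1) + ∑ ℓ, Real.log (f ℓ)) := by
      intro f hf
      rw [← mul_sum, ← sum_add_distrib]
      congr 1
      exact sum_congr rfl fun ℓ _ => Real.log_mul hc (hf ℓ).ne'
    rw [hsplit γ hγ, hsplit ωl fun ℓ => (hpos ℓ).1]
    linarith
  · intro hlt ω' _ hω'
    rcases hcase with ⟨-, -, h, -⟩ | ⟨h, -⟩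
    · rcases lt_trichotomy ω' ω with hc | hc | hc
      · exact absurd (sum_min_lt_sum_min hc (hω'.trans_lt hlt)) (by rw [hω', h]; exact lt_irrefl _)
      · exact hc
      · exact absurd (sum_min_lt_sum_min hc (h.trans_lt hlt)) (by rw [hω', h]; exact lt_irrefl _)
    · exact absurd hlt h.not_gt
end

section
/- Let 𝒳 be a nonempty finite set, n a positive integer, and c : 𝒳 × 𝒳 → [0,∞) a cost function with c_max = max_{x,x'} c(x,x'). Suppose X̃ⁿ, X̄ⁿ, Ỹⁿ, Ȳⁿ are 𝒳ⁿ-valued random vectors on a common probability space such that Ỹⁿ ↔ X̃ⁿ ↔ X̄ⁿ ↔ Ȳⁿ form a Markov chain. Then ∑_{t=1}^n E[c(X̃(t), X̄(t))] ≥ φ(p_{Ỹⁿ}, p_{Ȳⁿ}) − n·c_max·(P{X̃ⁿ ≠ Ỹⁿ} + P{X̄ⁿ ≠ Ȳⁿ}). -/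
open Finset

theorem transportCost_le_of_isCoupling {𝒳 : Type*} [Fintype 𝒳] {n : ℕ} {c : 𝒳 → 𝒳 → ℝ}
    (hc : ∀ x y, 0 ≤ c x y) {p q : (Fin n → 𝒳) → ℝ}
    {π : ((Fin n → 𝒳) × (Fin n → 𝒳)) → ℝ} (hπ : IsCoupling p q π) :
    transportCost n c p q ≤ ∑ z, π z * ∑ t, c (z.1 t) (z.2 t) := by
  refine csInf_le ⟨0, ?_⟩ ⟨π, hπ, rfl⟩
  rintro _ ⟨ρ, hρ, rfl⟩
  exact sum_nonneg fun z _ => mul_nonneg (hρ.1.1 z) (sum_nonneg fun t _ => hc _ _)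

theorem le_cMax {𝒳 : Type*} [Fintype 𝒳] [Nonempty 𝒳] (c : 𝒳 → 𝒳 → ℝ) (x y : 𝒳) :
    c x y ≤ cMax c :=
  Finset.le_sup' (fun z : 𝒳 × 𝒳 => c z.1 z.2) (mem_univ (x, y))

/-- Replacing the words `x`, `x'` by `y`, `y'` raises the total cost by at most `n * cMax c` for
each word that changes. -/
theorem sum_cost_le {𝒳 : Type*} [Fintype 𝒳] [DecidableEq 𝒳] [Nonempty 𝒳] {n : ℕ}
    {c : 𝒳 → 𝒳 → ℝ} (hc : ∀ x y, 0 ≤ c x y) (x x' y y' : Fin n → 𝒳) :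
    ∑ t, c (y t) (y' t) ≤ ∑ t, c (x t) (x' t) +
      n * cMax c * ((if x ≠ y then 1 else 0) + if x' ≠ y' then 1 else 0) := by
  have hle : ∑ t, c (y t) (y' t) ≤ n * cMax c := by
    simpa using sum_le_card_nsmul univ _ (cMax c) fun t _ => le_cMax c (y t) (y' t)
  have h0 : 0 ≤ ∑ t, c (y t) (y' t) := sum_nonneg fun t _ => hc _ _
  have h1 : 0 ≤ ∑ t, c (x t) (x' t) := sum_nonneg fun t _ => hc _ _
  by_cases h : x = y
  · by_cases h' : x' = y'
    · simp [h, h']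
    · simpa [h, h'] using hle.trans (le_add_of_nonneg_left (h ▸ h1))
  · by_cases h' : x' = y'
    · simpa [h, h'] using hle.trans (le_add_of_nonneg_left (h' ▸ h1))
    · simp only [ne_eq, h, h', not_false_eq_true, if_true]
      linarith

/-- The law of the two outer variables of a four-variable pmf couples its outer marginals. -/
theorem isCoupling_outer {α : Type*} [Fintype α] {q : α → α → α → α → ℝ}
    (h0 : ∀ a b c d, 0 ≤ q a b c d) (h1 : ∑ a, ∑ b, ∑ c, ∑ d, q a b c d = 1) :
    IsCoupling (fun a => ∑ b, ∑ c, ∑ d, q a b c d) (fun d => ∑ a, ∑ b, ∑ c, q a b c d)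
      (fun z => ∑ b, ∑ c, q z.1 b c z.2) := by
  have hfst (a : α) : ∑ d, ∑ b, ∑ c, q a b c d = ∑ b, ∑ c, ∑ d, q a b c d := by
    rw [sum_comm]
    exact sum_congr rfl fun b _ => sum_comm
  refine ⟨⟨fun z => sum_nonneg fun b _ => sum_nonneg fun c _ => h0 _ _ _ _, ?_⟩, hfst,
    fun d => rfl⟩
  simp_rw [Fintype.sum_prod_type, hfst, h1]

theorem sum_markov_eq_one {α : Type*} [Fintype α] {A C : α → α → ℝ} {B : α × α → ℝ}
    (hA : ∀ x, IsPMF (A x)) (hB : IsPMF B) (hC : ∀ x, IsPMF (C x)) :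
    ∑ y, ∑ x, ∑ x', ∑ y', A x y * B (x, x') * C x' y' = 1 := by
  simp_rw [← mul_sum, (hC _).2, mul_one, ← mul_sum]
  rw [sum_comm]
  simp_rw [← sum_mul, (hA _).2, one_mul]
  rw [← Fintype.sum_prod_type, hB.2]

/-- Data-processing-type bound for the transport divergence along a Markov chain
`Ỹⁿ ↔ X̃ⁿ ↔ X̄ⁿ ↔ Ȳⁿ` (joint pmf `q(ỹ,x̃,x̄,ȳ) = p(ỹ|x̃)·p(x̃,x̄)·p(ȳ|x̄)`):
`∑_t E[c(X̃(t),X̄(t))] ≥ φ(p_{Ỹⁿ}, p_{Ȳⁿ}) − n·c_max·(P{X̃ⁿ≠Ỹⁿ} + P{X̄ⁿ≠Ȳⁿ})`. -/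
theorem transportCost_markov_bound {𝒳 : Type*} [Fintype 𝒳] [DecidableEq 𝒳] [Nonempty 𝒳]
    (n : ℕ) (hn : 0 < n) (c : 𝒳 → 𝒳 → ℝ)
    (hc0 : ∀ x y, 0 ≤ c x y) (hcz : ∀ x y, c x y = 0 ↔ x = y)
    (A : (Fin n → 𝒳) → (Fin n → 𝒳) → ℝ)   -- `p(ỹ|x̃)`
    (B : ((Fin n → 𝒳) × (Fin n → 𝒳)) → ℝ) -- `p(x̃,x̄)`
    (C : (Fin n → 𝒳) → (Fin n → 𝒳) → ℝ)   -- `p(ȳ|x̄)`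
    (hA : ∀ x, IsPMF (A x)) (hB : IsPMF B) (hC : ∀ x, IsPMF (C x))
    (q : (Fin n → 𝒳) → (Fin n → 𝒳) → (Fin n → 𝒳) → (Fin n → 𝒳) → ℝ)
    (hq : ∀ ytil xtil xbar ybar,
      q ytil xtil xbar ybar = A xtil ytil * B (xtil, xbar) * C xbar ybar) :
    (∑ ytil, ∑ xtil, ∑ xbar, ∑ ybar,
        q ytil xtil xbar ybar * ∑ t, c (xtil t) (xbar t)) ≥
      transportCost n c
          (fun ytil => ∑ xtil, ∑ xbar, ∑ ybar, q ytil xtil xbar ybar)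
          (fun ybar => ∑ ytil, ∑ xtil, ∑ xbar, q ytil xtil xbar ybar) -
        (n : ℝ) * cMax c *
          ((∑ ytil, ∑ xtil, ∑ xbar, ∑ ybar,
              if xtil ≠ ytil then q ytil xtil xbar ybar else 0) +
           (∑ ytil, ∑ xtil, ∑ xbar, ∑ ybar,
              if xbar ≠ ybar then q ytil xtil xbar ybar else 0)) := by
  have h0 (a b d e) : 0 ≤ q a b d e := by
    rw [hq]
    exact mul_nonneg (mul_nonneg ((hA b).1 a) (hB.1 _)) ((hC d).1 e)
  have h1 : ∑ a, ∑ b, ∑ d, ∑ e, q a b d e = 1 := by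
    simp_rw [hq]
    exact sum_markov_eq_one hA hB hC
  rw [ge_iff_le, sub_le_iff_le_add]
  refine (transportCost_le_of_isCoupling hc0 (isCoupling_outer h0 h1)).trans ?_
  simp_rw [Fintype.sum_prod_type, ← sum_add_distrib, mul_sum (a := (n : ℝ) * cMax c),
    ← sum_add_distrib, sum_mul]
  refine sum_le_sum fun a _ => ?_
  rw [sum_comm]
  refine sum_le_sum fun b _ => ?_
  rw [sum_comm]
  refine sum_le_sum fun d _ => sum_le_sum fun e _ => ?_
  refine (mul_le_mul_of_nonneg_left (sum_cost_le hc0 b d a e) (h0 a b d e)).trans_eq ?_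
  split_ifs <;> ring
end
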